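/- There exists a constant C > 0 such that for every integer n ≥ 2, ∑ over 6-tuples of positive integers (x₁,...,x₆) with x₁+x₂+x₃+x₄ = n, x₄+x₅ = x₃+x₆, and x₃ < x₄ of ∏_{i=1}^{6} x_i^(-5/7) ≤ C. -/

import Mathlib

lemma pow_ten_le_of_le_of_le {x a b : ℝ} (hx : 0 ≤ x) (ha : x ≤ a) (hb : x ≤ b) :
    x ^ 10 ≤ a ^ 5 * b ^ 5 := by
  calc x ^ 10 = x ^ 5 * x ^ 5 := by ring
    _ ≤ a ^ 5 * b ^ 5 := by
      have : 0 ≤ a := hx.trans ha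
      gcongr

lemma mul_pow_ten_le {a b d : ℝ} (ha : 0 ≤ a) (hb : 0 ≤ b) (hd : 0 ≤ d) :
    a ^ 10 * b ^ 10 * d ^ 10 ≤ a ^ 15 * b ^ 15 + a ^ 15 * d ^ 15 + b ^ 15 * d ^ 15 := by
  have key : ∀ {x y z : ℝ}, 0 ≤ x → 0 ≤ y → 0 ≤ z → z ≤ x → z ≤ y →
      x ^ 10 * y ^ 10 * z ^ 10 ≤ x ^ 15 * y ^ 15 := by
    intro x y z hx hy hz hzx hzy
    calc x ^ 10 * y ^ 10 * z ^ 10 ≤ x ^ 10 * y ^ 10 * (x ^ 5 * y ^ 5) := by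
          gcongr
          exact pow_ten_le_of_le_of_le hz hzx hzy
      _ = x ^ 15 * y ^ 15 := by ring
  have h1 : 0 ≤ a ^ 15 * b ^ 15 := by positivity
  have h2 : 0 ≤ a ^ 15 * d ^ 15 := by positivity
  have h3 : 0 ≤ b ^ 15 * d ^ 15 := by positivity
  by_cases hda : d ≤ a ∧ d ≤ b
  · linarith [key ha hb hd hda.1 hda.2]
  by_cases hba : b ≤ a ∧ b ≤ d
  · linarith [key ha hd hb hba.1 hba.2]
  · have hab : a ≤ b ∧ a ≤ d := by grind
    linarith [key hb hd ha hab.1 hab.2]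

/-- The summand is dominated by products of four factors with exponent `-15/14 < -1`. -/
lemma prod_rpow_le {a b c d e : ℕ} (hc : 0 < c) (hd : 0 < d) (he : 0 < e) :
    (a : ℝ) ^ (-5/7 : ℝ) * (b : ℝ) ^ (-5/7 : ℝ) * (c : ℝ) ^ (-5/7 : ℝ)
        * ((c + d : ℕ) : ℝ) ^ (-5/7 : ℝ) * (e : ℝ) ^ (-5/7 : ℝ)
        * ((e + d : ℕ) : ℝ) ^ (-5/7 : ℝ) ≤
      (c : ℝ) ^ (-15/14 : ℝ) * ((e : ℝ) ^ (-15/14 : ℝ)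
          * ((a : ℝ) ^ (-15/14 : ℝ) * (b : ℝ) ^ (-15/14 : ℝ)))
        + (c : ℝ) ^ (-15/14 : ℝ) * ((e : ℝ) ^ (-15/14 : ℝ)
          * ((a : ℝ) ^ (-15/14 : ℝ) * (d : ℝ) ^ (-15/14 : ℝ)))
        + (c : ℝ) ^ (-15/14 : ℝ) * ((e : ℝ) ^ (-15/14 : ℝ)
          * ((b : ℝ) ^ (-15/14 : ℝ) * (d : ℝ) ^ (-15/14 : ℝ))) := by
  have h10 (m : ℕ) : (m : ℝ) ^ (-5/7 : ℝ) = ((m : ℝ) ^ (-1/14 : ℝ)) ^ 10 := by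
    rw [← Real.rpow_mul_natCast (Nat.cast_nonneg m)]
    norm_num
  have h15 (m : ℕ) : (m : ℝ) ^ (-15/14 : ℝ) = ((m : ℝ) ^ (-1/14 : ℝ)) ^ 15 := by
    rw [← Real.rpow_mul_natCast (Nat.cast_nonneg m)]
    norm_num
  have anti {k m : ℕ} (hk : 0 < k) (hkm : k ≤ m) :
      (m : ℝ) ^ (-1/14 : ℝ) ≤ (k : ℝ) ^ (-1/14 : ℝ) :=
    Real.rpow_le_rpow_of_nonpos (by exact_mod_cast hk) (by exact_mod_cast hkm) (by norm_num)
  have nn (m : ℕ) : 0 ≤ (m : ℝ) ^ (-1/14 : ℝ) := by positivity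
  have hX := pow_ten_le_of_le_of_le (nn (c + d)) (anti hc (by omega : c ≤ c + d))
    (anti hd (by omega : d ≤ c + d))
  have hY := pow_ten_le_of_le_of_le (nn (e + d)) (anti he (by omega : e ≤ e + d))
    (anti hd (by omega : d ≤ e + d))
  have hM := mul_pow_ten_le (nn a) (nn b) (nn d)
  simp only [h10, h15]
  have hA := nn a
  have hB := nn b
  have hC := nn c
  have hD := nn d
  have hE := nn e
  have hX0 := nn (c + d)
  have hY0 := nn (e + d)
  generalize (a : ℝ) ^ (-1/14 : ℝ) = A at *
  generalize (b : ℝ) ^ (-1/14 : ℝ) = B at *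
  generalize (c : ℝ) ^ (-1/14 : ℝ) = C at *
  generalize (d : ℝ) ^ (-1/14 : ℝ) = D at *
  generalize (e : ℝ) ^ (-1/14 : ℝ) = E at *
  generalize ((c + d : ℕ) : ℝ) ^ (-1/14 : ℝ) = X at *
  generalize ((e + d : ℕ) : ℝ) ^ (-1/14 : ℝ) = Y at *
  calc A ^ 10 * B ^ 10 * C ^ 10 * X ^ 10 * E ^ 10 * Y ^ 10
      ≤ A ^ 10 * B ^ 10 * C ^ 10 * (C ^ 5 * D ^ 5) * E ^ 10 * (E ^ 5 * D ^ 5) := by gcongr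
    _ = C ^ 15 * E ^ 15 * (A ^ 10 * B ^ 10 * D ^ 10) := by ring
    _ ≤ C ^ 15 * E ^ 15 * (A ^ 15 * B ^ 15 + A ^ 15 * D ^ 15 + B ^ 15 * D ^ 15) := by gcongr
    _ = _ := by ring

theorem stmt10 :
    ∃ C : ℝ, 0 < C ∧ ∀ n : ℕ, 2 ≤ n →
      (∑' p : {p : Fin 6 → ℕ // (∀ i, 0 < p i) ∧ p 0 + p 1 + p 2 + p 3 = n ∧
          p 3 + p 4 = p 2 + p 5 ∧ p 2 < p 3},
        ∏ i, ((p : Fin 6 → ℕ) i : ℝ) ^ (-5/7 : ℝ)) ≤ C := by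
  let f : ℕ → ℝ := fun m => (m : ℝ) ^ (-15/14 : ℝ)
  have hf0 : 0 ≤ f := fun m => by positivity
  have hf : Summable f := Real.summable_nat_rpow.2 (by norm_num)
  let g : ℕ × ℕ × ℕ × ℕ → ℝ := fun w => f w.1 * (f w.2.1 * (f w.2.2.1 * f w.2.2.2))
  have hg0 : ∀ w, 0 ≤ g w := fun w =>
    mul_nonneg (hf0 _) (mul_nonneg (hf0 _) (mul_nonneg (hf0 _) (hf0 _)))
  have hg : Summable g := by
    have h2 := hf.mul_of_nonneg hf hf0 hf0
    have h3 := hf.mul_of_nonneg h2 hf0 (fun w => mul_nonneg (hf0 _) (hf0 _))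
    exact hf.mul_of_nonneg h3 hf0
      (fun w => mul_nonneg (hf0 _) (mul_nonneg (hf0 _) (hf0 _)))
  have hpos : 0 ≤ ∑' w, g w := tsum_nonneg hg0
  refine ⟨3 * (∑' w, g w) + 1, by positivity, fun n _ => ?_⟩
  let S := {p : Fin 6 → ℕ // (∀ i, 0 < p i) ∧ p 0 + p 1 + p 2 + p 3 = n ∧
    p 3 + p 4 = p 2 + p 5 ∧ p 2 < p 3}
  let u : S → ℕ × ℕ × ℕ × ℕ := fun p => (p.1 2, p.1 4, p.1 0, p.1 1)
  let v : S → ℕ × ℕ × ℕ × ℕ := fun p => (p.1 2, p.1 4, p.1 0, p.1 3 - p.1 2)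
  let w : S → ℕ × ℕ × ℕ × ℕ := fun p => (p.1 2, p.1 4, p.1 1, p.1 3 - p.1 2)
  have hu : Function.Injective u := by
    intro ⟨p, _, hp, hp', hp''⟩ ⟨q, _, hq, hq', hq''⟩ h
    simp only [u, Prod.mk.injEq] at h
    ext i
    fin_cases i <;> simp <;> omega
  have hv : Function.Injective v := by
    intro ⟨p, _, hp, hp', hp''⟩ ⟨q, _, hq, hq', hq''⟩ h
    simp only [v, Prod.mk.injEq] at h
    ext i
    fin_cases i <;> simp <;> omega
  have hw : Function.Injective w := by
    intro ⟨p, _, hp, hp', hp''⟩ ⟨q, _, hq, hq', hq''⟩ h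
    simp only [w, Prod.mk.injEq] at h
    ext i
    fin_cases i <;> simp <;> omega
  have su := hg.comp_injective hu
  have sv := hg.comp_injective hv
  have sw := hg.comp_injective hw
  have hle : ∀ p : S, ∏ i, (p.1 i : ℝ) ^ (-5/7 : ℝ) ≤
      (g ∘ u) p + (g ∘ v) p + (g ∘ w) p := by
    intro ⟨p, hp0, _, hp', hp''⟩
    have h3 : p 3 = p 2 + (p 3 - p 2) := by omega
    have h5 : p 5 = p 4 + (p 3 - p 2) := by omega
    have := prod_rpow_le (a := p 0) (b := p 1) (hp0 2) (by omega : 0 < p 3 - p 2) (hp0 4)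
    rw [← h3, ← h5] at this
    rw [Fin.prod_univ_six]
    exact this
  have hsum := (su.add sv).add sw
  have h := (hsum.of_nonneg_of_le (fun p => by positivity) hle).tsum_le_tsum hle hsum
  rw [(su.add sv).tsum_add sw, su.tsum_add sv] at h
  have tu := tsum_comp_le_tsum_of_inj hg hg0 hu
  have tv := tsum_comp_le_tsum_of_inj hg hg0 hv
  have tw := tsum_comp_le_tsum_of_inj hg hg0 hw
  linarith
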